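/- Let M ⊨ DB₀ and let n ≥ 0 be a natural number. The following are equivalent: (1) M has property end_{n+1}; (2) M ⊨ Coll_s(Σ_{n+1}); (3) if n = 0: for every N ⊨ DB₀ with M ≺_{Σ₁} N one has M* ≺_{Σ₁} N; and if n ≥ 1: M ⊨ Coll(Σ_n), and for every N ⊨ DB₀ + Coll(Σ_n) with M ≺_{Σ_{n+1}} N one has M* ≺_{Σ_{n+1}} N. -/

import Mathlib

/- A deep embedding of the first-order language of set theory L_∈ = {∈, =},
   with named variables indexed by ℕ. -/

namespace FOSet

/-- Formulas of L_∈ with variables indexed by ℕ. -/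
inductive Fml : Type
  | mem : ℕ → ℕ → Fml
  | eq  : ℕ → ℕ → Fml
  | not : Fml → Fml
  | and : Fml → Fml → Fml
  | or  : Fml → Fml → Fml
  | imp : Fml → Fml → Fml
  | all : ℕ → Fml → Fml
  | ex  : ℕ → Fml → Fml

namespace Fml

/-- Free variables of a formula. -/
def fv : Fml → Set ℕ
  | mem i j => {i, j}
  | eq i j  => {i, j}
  | not φ   => φ.fv
  | and φ ψ => φ.fv ∪ ψ.fv
  | or φ ψ  => φ.fv ∪ ψ.fv
  | imp φ ψ => φ.fv ∪ ψ.fv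
  | all i φ => φ.fv \ {i}
  | ex i φ  => φ.fv \ {i}

end Fml

/-- Satisfaction, in the substructure of `(N, E)` with domain `S`, of a formula
under a valuation `v` : quantifiers range over `S`. -/
def SatIn {N : Type} (E : N → N → Prop) (S : Set N) : (ℕ → N) → Fml → Prop
  | v, .mem i j => E (v i) (v j)
  | v, .eq i j  => v i = v j
  | v, .not φ   => ¬ SatIn E S v φ
  | v, .and φ ψ => SatIn E S v φ ∧ SatIn E S v ψ
  | v, .or φ ψ  => SatIn E S v φ ∨ SatIn E S v ψ
  | v, .imp φ ψ => SatIn E S v φ → SatIn E S v ψ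
  | v, .all i φ => ∀ a ∈ S, SatIn E S (Function.update v i a) φ
  | v, .ex i φ  => ∃ a ∈ S, SatIn E S (Function.update v i a) φ

/-- Satisfaction in the full structure `(N, E)`. -/
def Sat {N : Type} (E : N → N → Prop) (v : ℕ → N) (φ : Fml) : Prop :=
  SatIn E Set.univ v φ

/-- Δ₀ (= Σ₀ = Π₀) formulas: every quantifier is bounded, i.e. of the form
`∀ x ∈ y` or `∃ x ∈ y`. -/
inductive IsDelta0 : Fml → Prop
  | mem (i j : ℕ) : IsDelta0 (Fml.mem i j)
  | eq (i j : ℕ)  : IsDelta0 (Fml.eq i j)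
  | not {φ} : IsDelta0 φ → IsDelta0 φ.not
  | and {φ ψ} : IsDelta0 φ → IsDelta0 ψ → IsDelta0 (φ.and ψ)
  | or {φ ψ}  : IsDelta0 φ → IsDelta0 ψ → IsDelta0 (φ.or ψ)
  | imp {φ ψ} : IsDelta0 φ → IsDelta0 ψ → IsDelta0 (φ.imp ψ)
  | ball {i j : ℕ} {φ} : i ≠ j → IsDelta0 φ →
      IsDelta0 (Fml.all i ((Fml.mem i j).imp φ))
  | bex {i j : ℕ} {φ} : i ≠ j → IsDelta0 φ →
      IsDelta0 (Fml.ex i ((Fml.mem i j).and φ))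

/-- The Lévy hierarchy: `(levels n).1` is the class of Σ_n formulas and
`(levels n).2` the class of Π_n formulas. -/
def levels : ℕ → (Fml → Prop) × (Fml → Prop)
  | 0 => (IsDelta0, IsDelta0)
  | n + 1 =>
      (fun φ => ∃ i ψ, (levels n).2 ψ ∧ φ = Fml.ex i ψ,
       fun φ => ∃ i ψ, (levels n).1 ψ ∧ φ = Fml.all i ψ)

def IsSigma (n : ℕ) : Fml → Prop := (levels n).1

def IsPi (n : ℕ) : Fml → Prop := (levels n).2

variable {M N : Type}

/-- `p` is the (Kuratowski) pair `{a, b}` in the sense of `E`. -/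
def IsPairOf (E : M → M → Prop) (p a b : M) : Prop :=
  ∀ w, E w p ↔ (w = a ∨ w = b)

/-- `z` is the ordered pair `(a, b)` (Kuratowski) in the sense of `E`. -/
def IsOPairOf (E : M → M → Prop) (z a b : M) : Prop :=
  ∃ s t, IsPairOf E s a a ∧ IsPairOf E t a b ∧ IsPairOf E z s t

/-- Valuation sending variable 0 to `x` and every other variable to `y`;
used for formulas φ(x, y) with free variables among {0, 1}. -/
def val2 (x y : M) : ℕ → M := fun k => if k = 0 then x else y

/-- Valuation sending 0 ↦ x, 1 ↦ y, everything else ↦ v;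
used for formulas φ(x, y, v) with free variables among {0, 1, 2}. -/
def val3 (x y v : M) : ℕ → M := fun k => if k = 0 then x else if k = 1 then y else v

/-- `M ⊨ Sep(φ)` for φ = φ(x, v) (x is variable 0, v is variable 1):
∀v∀p∃q∀x(x∈q ↔ x∈p ∧ φ(x,v)). -/
def SepAx (E : M → M → Prop) (φ : Fml) : Prop :=
  ∀ v p : M, ∃ q : M, ∀ x : M, E x q ↔ (E x p ∧ Sat E (val2 x v) φ)

/-- `M ⊨ Sep⁻(φ)` for a parameter-free φ = φ(x) (x is variable 0). -/
def SepMinusAx (E : M → M → Prop) (φ : Fml) : Prop :=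
  ∀ p : M, ∃ q : M, ∀ x : M, E x q ↔ (E x p ∧ Sat E (fun _ => x) φ)

/-- `(M, E) ⊨ DB₀`: extensionality, empty set, pairing, union, cartesian
product, and Δ₀ separation. -/
def SatDB0 (E : M → M → Prop) : Prop :=
  (∀ a b : M, (∀ x, E x a ↔ E x b) → a = b) ∧
  (∃ e : M, ∀ x, ¬ E x e) ∧
  (∀ a b : M, ∃ p, IsPairOf E p a b) ∧
  (∀ a : M, ∃ u, ∀ x, E x u ↔ ∃ y, E y a ∧ E x y) ∧
  (∀ a b : M, ∃ c, ∀ z, E z c ↔ ∃ x y, E x a ∧ E y b ∧ IsOPairOf E z x y) ∧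
  (∀ φ, IsDelta0 φ → φ.fv ⊆ {0, 1} → SepAx E φ)

/-- `M ⊨ Coll(φ)` for φ = φ(x, y, v) (x = var 0, y = var 1, v = var 2):
∀v∀p(∀x∈p ∃y φ → ∃q ∀x∈p ∃y∈q φ). -/
def CollAx (E : M → M → Prop) (φ : Fml) : Prop :=
  ∀ v p : M, (∀ x, E x p → ∃ y, Sat E (val3 x y v) φ) →
    ∃ q, ∀ x, E x p → ∃ y, E y q ∧ Sat E (val3 x y v) φ

/-- `M ⊨ Coll_s(φ)`: ∀v∀p∃q∀x∈p(∃y φ ↔ ∃y∈q φ). -/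
def CollSAx (E : M → M → Prop) (φ : Fml) : Prop :=
  ∀ v p : M, ∃ q, ∀ x, E x p →
    ((∃ y, Sat E (val3 x y v) φ) ↔ ∃ y, E y q ∧ Sat E (val3 x y v) φ)

/-- `M ⊨ Coll_w(φ)`: ∀v(∀x∃y φ → ∀p∃q∀x∈p∃y∈q φ). -/
def CollWAx (E : M → M → Prop) (φ : Fml) : Prop :=
  ∀ v : M, (∀ x, ∃ y, Sat E (val3 x y v) φ) →
    ∀ p, ∃ q, ∀ x, E x p → ∃ y, E y q ∧ Sat E (val3 x y v) φ

/-- `M ⊨ Coll⁻(φ)` for a parameter-free φ = φ(x, y) (x = var 0, y = var 1). -/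
def CollMinusAx (E : M → M → Prop) (φ : Fml) : Prop :=
  ∀ p : M, (∀ x, E x p → ∃ y, Sat E (val2 x y) φ) →
    ∃ q, ∀ x, E x p → ∃ y, E y q ∧ Sat E (val2 x y) φ

/-- `M ⊨ Coll_w⁻(φ)` for a parameter-free φ = φ(x, y). -/
def CollWMinusAx (E : M → M → Prop) (φ : Fml) : Prop :=
  (∀ x : M, ∃ y, Sat E (val2 x y) φ) →
    ∀ p, ∃ q, ∀ x, E x p → ∃ y, E y q ∧ Sat E (val2 x y) φ

/-- `M ⊨ Coll_s⁻(φ)` for a parameter-free φ = φ(x, y). -/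
def CollSMinusAx (E : M → M → Prop) (φ : Fml) : Prop :=
  ∀ p : M, ∃ q, ∀ x, E x p →
    ((∃ y, Sat E (val2 x y) φ) ↔ ∃ y, E y q ∧ Sat E (val2 x y) φ)

/- Schemas over a class Γ of formulas. -/

def CollScheme (E : M → M → Prop) (Γ : Fml → Prop) : Prop :=
  ∀ φ, Γ φ → φ.fv ⊆ {0, 1, 2} → CollAx E φ

def CollSScheme (E : M → M → Prop) (Γ : Fml → Prop) : Prop :=
  ∀ φ, Γ φ → φ.fv ⊆ {0, 1, 2} → CollSAx E φ

def CollWScheme (E : M → M → Prop) (Γ : Fml → Prop) : Prop :=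
  ∀ φ, Γ φ → φ.fv ⊆ {0, 1, 2} → CollWAx E φ

def CollMinusScheme (E : M → M → Prop) (Γ : Fml → Prop) : Prop :=
  ∀ φ, Γ φ → φ.fv ⊆ {0, 1} → CollMinusAx E φ

def CollWMinusScheme (E : M → M → Prop) (Γ : Fml → Prop) : Prop :=
  ∀ φ, Γ φ → φ.fv ⊆ {0, 1} → CollWMinusAx E φ

def CollSMinusScheme (E : M → M → Prop) (Γ : Fml → Prop) : Prop :=
  ∀ φ, Γ φ → φ.fv ⊆ {0, 1} → CollSMinusAx E φ

def SepScheme (E : M → M → Prop) (Γ : Fml → Prop) : Prop :=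
  ∀ φ, Γ φ → φ.fv ⊆ {0, 1} → SepAx E φ

def SepMinusScheme (E : M → M → Prop) (Γ : Fml → Prop) : Prop :=
  ∀ φ, Γ φ → φ.fv ⊆ {0} → SepMinusAx E φ

/- Extensions. We present an extension `M ⊆ N` by an embedding `f : M → N`. -/

/-- `f` embeds `(M, EM)` as a substructure of `(N, EN)`. -/
def SubStr (EM : M → M → Prop) (EN : N → N → Prop) (f : M → N) : Prop :=
  Function.Injective f ∧ ∀ a b : M, EM a b ↔ EN (f a) (f b)

/-- `f : M → N` is a (fully) elementary embedding. -/
def ElemEmb (EM : M → M → Prop) (EN : N → N → Prop) (f : M → N) : Prop :=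
  ∀ (φ : Fml) (v : ℕ → M), Sat EM v φ ↔ Sat EN (f ∘ v) φ

/-- `f : M → N` is a Σ_n-elementary embedding (M ≺_{Σ_n} N). -/
def SigmaElemEmb (n : ℕ) (EM : M → M → Prop) (EN : N → N → Prop) (f : M → N) : Prop :=
  ∀ φ, IsSigma n φ → ∀ v : ℕ → M, Sat EM v φ ↔ Sat EN (f ∘ v) φ

/-- `f : M → N` is a Δ₀-elementary embedding (M ≺_{Δ₀} N). -/
def Delta0ElemEmb (EM : M → M → Prop) (EN : N → N → Prop) (f : M → N) : Prop :=
  ∀ φ, IsDelta0 φ → ∀ v : ℕ → M, Sat EM v φ ↔ Sat EN (f ∘ v) φ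

/-- The convex hull M* of (the image of) M in N:
{a ∈ N : N ⊨ a ∈ m for some m ∈ M}. -/
def hull (EN : N → N → Prop) (f : M → N) : Set N := {a | ∃ m : M, EN a (f m)}

/-- The substructure of `N` with domain `S` is a Σ_n-elementary substructure of
`N` (S ≺_{Σ_n} N). -/
def SigmaElemInTop (n : ℕ) (EN : N → N → Prop) (S : Set N) : Prop :=
  ∀ φ, IsSigma n φ → ∀ v : ℕ → N, (∀ k, v k ∈ S) → (SatIn EN S v φ ↔ Sat EN v φ)

/-- The substructure of `N` with domain `S` is a fully elementary substructure. -/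
def ElemInTop (EN : N → N → Prop) (S : Set N) : Prop :=
  ∀ (φ : Fml) (v : ℕ → N), (∀ k, v k ∈ S) → (SatIn EN S v φ ↔ Sat EN v φ)

/-- `f` is a Σ_n-elementary embedding of `M` into the substructure of `N` with
domain `S` (e.g. M ≺_{Σ_n} M*). -/
def SigmaElemEmbInto (n : ℕ) (EM : M → M → Prop) (EN : N → N → Prop) (f : M → N)
    (S : Set N) : Prop :=
  ∀ φ, IsSigma n φ → ∀ v : ℕ → M, Sat EM v φ ↔ SatIn EN S (f ∘ v) φ

/-- `f` is a fully elementary embedding of `M` into the substructure of `N`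
with domain `S`. -/
def ElemEmbInto (EM : M → M → Prop) (EN : N → N → Prop) (f : M → N) (S : Set N) : Prop :=
  ∀ (φ : Fml) (v : ℕ → M), Sat EM v φ ↔ SatIn EN S (f ∘ v) φ

/-- The extension presented by `f` is an end extension. -/
def IsEndEmb (EN : N → N → Prop) (f : M → N) : Prop :=
  ∀ (m : M) (a : N), EN a (f m) → ∃ m', f m' = a

/-- The extension presented by `f` is cofinal. -/
def Cofinal (EN : N → N → Prop) (f : M → N) : Prop :=
  ∀ a : N, ∃ m : M, EN a (f m)

/-- `a` is a transitive set in the sense of `(N, EN)`. -/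
def TransIn (EN : N → N → Prop) (a : N) : Prop :=
  ∀ x, EN x a → ∀ y, EN y x → EN y a

/-- The extension presented by `f` is taller. -/
def Taller (EN : N → N → Prop) (f : M → N) : Prop :=
  ∃ a : N, ∀ m : M, EN (f m) a

/-- The extension presented by `f` is taller*. -/
def TallerStar (EN : N → N → Prop) (f : M → N) : Prop :=
  ∃ a : N, (∀ m : M, EN (f m) a) ∧ TransIn EN a

/-- Property end_n: for every elementary extension N of M, M* ≺_{Σ_n} N. -/
def HasEnd (n : ℕ) (EM : M → M → Prop) : Prop :=
  ∀ (N : Type) (EN : N → N → Prop) (f : M → N), ElemEmb EM EN f →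
    SigmaElemInTop n EN (hull EN f)

/-- Property cof_n: for every elementary extension N of M, M ≺_{Σ_n} M*. -/
def HasCof (n : ℕ) (EM : M → M → Prop) : Prop :=
  ∀ (N : Type) (EN : N → N → Prop) (f : M → N), ElemEmb EM EN f →
    SigmaElemEmbInto n EM EN f (hull EN f)

/-- Property COF_n: for every Δ₀-elementary cofinal extension N of M with
N ⊨ DB₀, M ≺_{Σ_n} N. -/
def HasCOF (n : ℕ) (EM : M → M → Prop) : Prop :=
  ∀ (N : Type) (EN : N → N → Prop) (f : M → N), SatDB0 EN →
    Delta0ElemEmb EM EN f → Cofinal EN f → SigmaElemEmb n EM EN f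

/-- TCo: every set is an element of some transitive set. -/
def SatTCo (E : M → M → Prop) : Prop :=
  ∀ a : M, ∃ t, E a t ∧ TransIn E t

/-- `a` is an ordinal in the sense of `(M, E)`: a transitive set linearly
ordered by `E`. -/
def OrdIn (E : M → M → Prop) (a : M) : Prop :=
  TransIn E a ∧ ∀ x y, E x a → E y a → (E x y ∨ x = y ∨ E y x)

/-- The formula φ(p, α, v) (p = var 0, α = var 1, v = var 2), with parameter
`v ∈ M`, defines a resolution on `(M, E)`. -/
def IsResolution (E : M → M → Prop) (φ : Fml) (v : M) : Prop :=
  φ.fv ⊆ {0, 1, 2} ∧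
  (∀ α, OrdIn E α → ∃! p, Sat E (val3 p α v) φ) ∧
  (∀ α β p q, E α β → Sat E (val3 p α v) φ → Sat E (val3 q β v) φ →
    ∀ x, E x p → E x q) ∧
  (∀ x, ∃ α, OrdIn E α ∧ ∀ p, Sat E (val3 p α v) φ → E x p)

end FOSet

namespace FOSet

open Filter

section Renaming

variable {N : Type}

theorem fv_finite (φ : Fml) : φ.fv.Finite := by
  induction φ with
  | mem i j => exact Set.toFinite {i, j}
  | eq i j => exact Set.toFinite {i, j}
  | not φ ih => exact ih
  | and φ ψ ih₁ ih₂ => exact ih₁.union ih₂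
  | or φ ψ ih₁ ih₂ => exact ih₁.union ih₂
  | imp φ ψ ih₁ ih₂ => exact ih₁.union ih₂
  | all i φ ih => exact ih.sdiff
  | ex i φ ih => exact ih.sdiff

theorem satIn_congr (E : N → N → Prop) (S : Set N) (φ : Fml) (v w : ℕ → N)
    (h : ∀ k ∈ φ.fv, v k = w k) : SatIn E S v φ ↔ SatIn E S w φ := by
  induction φ generalizing v w with
  | mem i j => simp [SatIn, h i (by simp [Fml.fv]), h j (by simp [Fml.fv])]
  | eq i j => simp [SatIn, h i (by simp [Fml.fv]), h j (by simp [Fml.fv])]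
  | not φ ih => simp only [SatIn, ih v w h]
  | and φ ψ ih₁ ih₂ =>
    simp only [SatIn, ih₁ v w fun k hk => h k (Or.inl hk), ih₂ v w fun k hk => h k (Or.inr hk)]
  | or φ ψ ih₁ ih₂ =>
    simp only [SatIn, ih₁ v w fun k hk => h k (Or.inl hk), ih₂ v w fun k hk => h k (Or.inr hk)]
  | imp φ ψ ih₁ ih₂ =>
    simp only [SatIn, ih₁ v w fun k hk => h k (Or.inl hk), ih₂ v w fun k hk => h k (Or.inr hk)]
  | all i φ ih =>
    refine forall₂_congr fun a _ => ih _ _ fun k hk => ?_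
    by_cases hki : k = i
    · simp [hki]
    · simp [hki, h k ⟨hk, hki⟩]
  | ex i φ ih =>
    refine exists_congr fun a => and_congr_right fun _ => ih _ _ fun k hk => ?_
    by_cases hki : k = i
    · simp [hki]
    · simp [hki, h k ⟨hk, hki⟩]

theorem sat_congr (E : N → N → Prop) (φ : Fml) (v w : ℕ → N)
    (h : ∀ k ∈ φ.fv, v k = w k) : Sat E v φ ↔ Sat E w φ :=
  satIn_congr E _ φ v w h

/-- Satisfaction in the substructure with domain `S`, as satisfaction in the subtype. -/
theorem sat_subtype (E : N → N → Prop) (S : Set N) (φ : Fml) (v : ℕ → S) :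
    Sat (fun a b : S => E a b) v φ ↔ SatIn E S (fun k => (v k : N)) φ := by
  have key : ∀ (v : ℕ → S) (i : ℕ) (a : S),
      (fun k => ((Function.update v i a) k : N)) = Function.update (fun k => (v k : N)) i a := by
    intro v i a
    funext k
    by_cases hk : k = i
    · subst hk; simp
    · simp [hk]
  unfold Sat
  induction φ generalizing v with
  | mem i j => rfl
  | eq i j => exact Subtype.ext_iff
  | not φ ih => simp only [SatIn, ih]
  | and φ ψ ih₁ ih₂ => simp only [SatIn, ih₁, ih₂]
  | or φ ψ ih₁ ih₂ => simp only [SatIn, ih₁, ih₂]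
  | imp φ ψ ih₁ ih₂ => simp only [SatIn, ih₁, ih₂]
  | all i φ ih => simp [SatIn, ih, key]
  | ex i φ ih => simp [SatIn, ih, key]

section simp_lemmas

variable (E : N → N → Prop) (v : ℕ → N) (i j : ℕ) (φ ψ : Fml)

theorem sat_mem : Sat E v (.mem i j) ↔ E (v i) (v j) := Iff.rfl
theorem sat_eq : Sat E v (.eq i j) ↔ v i = v j := Iff.rfl
theorem sat_not : Sat E v φ.not ↔ ¬ Sat E v φ := Iff.rfl
theorem sat_and : Sat E v (φ.and ψ) ↔ Sat E v φ ∧ Sat E v ψ := Iff.rfl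
theorem sat_or : Sat E v (φ.or ψ) ↔ Sat E v φ ∨ Sat E v ψ := Iff.rfl
theorem sat_imp : Sat E v (φ.imp ψ) ↔ (Sat E v φ → Sat E v ψ) := Iff.rfl
theorem sat_all : Sat E v (.all i φ) ↔ ∀ a, Sat E (Function.update v i a) φ := by
  simp [Sat, SatIn]
theorem sat_ex : Sat E v (.ex i φ) ↔ ∃ a, Sat E (Function.update v i a) φ := by
  simp [Sat, SatIn]

end simp_lemmas

theorem exists_fresh (φ : Fml) (ρ : ℕ → ℕ) : ∃ k, k ∉ ρ '' φ.fv :=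
  ((fv_finite φ).image ρ).exists_notMem

/-- Capture-avoiding renaming of the free variables of a formula. -/
noncomputable def Fml.rename : (ℕ → ℕ) → Fml → Fml
  | ρ, .mem i j => .mem (ρ i) (ρ j)
  | ρ, .eq i j => .eq (ρ i) (ρ j)
  | ρ, .not φ => .not (φ.rename ρ)
  | ρ, .and φ ψ => .and (φ.rename ρ) (ψ.rename ρ)
  | ρ, .or φ ψ => .or (φ.rename ρ) (ψ.rename ρ)
  | ρ, .imp φ ψ => .imp (φ.rename ρ) (ψ.rename ρ)
  | ρ, .all i φ => .all (exists_fresh φ ρ).choose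
      (φ.rename (Function.update ρ i (exists_fresh φ ρ).choose))
  | ρ, .ex i φ => .ex (exists_fresh φ ρ).choose
      (φ.rename (Function.update ρ i (exists_fresh φ ρ).choose))

theorem update_comp_update_apply {ρ : ℕ → ℕ} {φ : Fml} {m : ℕ} (hm : m ∉ ρ '' φ.fv)
    (v : ℕ → N) (i : ℕ) (a : N) :
    ∀ k ∈ φ.fv, (Function.update v m a ∘ Function.update ρ i m) k =
      Function.update (v ∘ ρ) i a k := by
  intro k hk
  by_cases hki : k = i
  · subst hki; simp
  · have : ρ k ≠ m := fun h => hm ⟨k, hk, h⟩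
    simp [hki, this]

theorem sat_rename (E : N → N → Prop) (ρ : ℕ → ℕ) (φ : Fml) (v : ℕ → N) :
    Sat E v (φ.rename ρ) ↔ Sat E (v ∘ ρ) φ := by
  induction φ generalizing v ρ with
  | mem i j => rfl
  | eq i j => rfl
  | not φ ih => simp only [Fml.rename, sat_not, ih]
  | and φ ψ ih₁ ih₂ => simp only [Fml.rename, sat_and, ih₁, ih₂]
  | or φ ψ ih₁ ih₂ => simp only [Fml.rename, sat_or, ih₁, ih₂]
  | imp φ ψ ih₁ ih₂ => simp only [Fml.rename, sat_imp, ih₁, ih₂]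
  | all i φ ih =>
    simp only [Fml.rename, sat_all, ih]
    exact forall_congr' fun a => sat_congr _ _ _ _
      (update_comp_update_apply (exists_fresh φ ρ).choose_spec v i a)
  | ex i φ ih =>
    simp only [Fml.rename, sat_ex, ih]
    exact exists_congr fun a => sat_congr _ _ _ _
      (update_comp_update_apply (exists_fresh φ ρ).choose_spec v i a)

theorem fv_rename_aux {ρ : ℕ → ℕ} {φ ψ : Fml} {i m : ℕ}
    (h : ψ.fv ⊆ Function.update ρ i m '' φ.fv) : ψ.fv \ {m} ⊆ ρ '' (φ.fv \ {i}) := by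
  rintro y ⟨hy, hym⟩
  obtain ⟨x, hx, rfl⟩ := h hy
  by_cases hxi : x = i
  · subst hxi; simp at hym
  · exact ⟨x, ⟨hx, hxi⟩, by simp [hxi]⟩

theorem fv_rename (ρ : ℕ → ℕ) (φ : Fml) : (φ.rename ρ).fv ⊆ ρ '' φ.fv := by
  induction φ generalizing ρ with
  | mem i j => simp [Fml.rename, Fml.fv, Set.image_pair]
  | eq i j => simp [Fml.rename, Fml.fv, Set.image_pair]
  | not φ ih => exact ih ρ
  | and φ ψ ih₁ ih₂ =>
    simp only [Fml.rename, Fml.fv, Set.image_union]; exact Set.union_subset_union (ih₁ ρ) (ih₂ ρ)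
  | or φ ψ ih₁ ih₂ =>
    simp only [Fml.rename, Fml.fv, Set.image_union]; exact Set.union_subset_union (ih₁ ρ) (ih₂ ρ)
  | imp φ ψ ih₁ ih₂ =>
    simp only [Fml.rename, Fml.fv, Set.image_union]; exact Set.union_subset_union (ih₁ ρ) (ih₂ ρ)
  | all i φ ih => exact fv_rename_aux (ih _)
  | ex i φ ih => exact fv_rename_aux (ih _)

theorem IsDelta0.rename {φ : Fml} (h : IsDelta0 φ) (ρ : ℕ → ℕ) : IsDelta0 (φ.rename ρ) := by
  induction h generalizing ρ with
  | mem i j => exact .mem _ _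
  | eq i j => exact .eq _ _
  | not _ ih => exact .not (ih ρ)
  | and _ _ ih₁ ih₂ => exact .and (ih₁ ρ) (ih₂ ρ)
  | or _ _ ih₁ ih₂ => exact .or (ih₁ ρ) (ih₂ ρ)
  | imp _ _ ih₁ ih₂ => exact .imp (ih₁ ρ) (ih₂ ρ)
  | @ball i j φ hij _ ih =>
    have hm := (exists_fresh ((Fml.mem i j).imp φ) ρ).choose_spec
    simp only [Fml.rename]
    rw [Function.update_self, Function.update_of_ne hij.symm]
    exact .ball (fun h => hm ⟨j, by simp [Fml.fv], h.symm⟩) (ih _)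
  | @bex i j φ hij _ ih =>
    have hm := (exists_fresh ((Fml.mem i j).and φ) ρ).choose_spec
    simp only [Fml.rename]
    rw [Function.update_self, Function.update_of_ne hij.symm]
    exact .bex (fun h => hm ⟨j, by simp [Fml.fv], h.symm⟩) (ih _)

theorem levels_rename (n : ℕ) : (∀ φ, IsSigma n φ → ∀ ρ, IsSigma n (φ.rename ρ)) ∧
    (∀ φ, IsPi n φ → ∀ ρ, IsPi n (φ.rename ρ)) := by
  induction n with
  | zero => exact ⟨fun φ h ρ => IsDelta0.rename h ρ, fun φ h ρ => IsDelta0.rename h ρ⟩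
  | succ n ih =>
    constructor
    · rintro _ ⟨i, ψ, hψ, rfl⟩ ρ
      exact ⟨_, _, ih.2 ψ hψ _, rfl⟩
    · rintro _ ⟨i, ψ, hψ, rfl⟩ ρ
      exact ⟨_, _, ih.1 ψ hψ _, rfl⟩

theorem exists_dual (n : ℕ) :
    (∀ φ, IsSigma n φ → ∃ ψ, IsPi n ψ ∧
      ∀ (N : Type) (E : N → N → Prop) v, Sat E v ψ ↔ ¬ Sat E v φ) ∧
    (∀ φ, IsPi n φ → ∃ ψ, IsSigma n ψ ∧
      ∀ (N : Type) (E : N → N → Prop) v, Sat E v ψ ↔ ¬ Sat E v φ) := by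
  induction n with
  | zero => exact ⟨fun φ h => ⟨φ.not, .not h, fun _ _ _ => Iff.rfl⟩,
      fun φ h => ⟨φ.not, .not h, fun _ _ _ => Iff.rfl⟩⟩
  | succ n ih =>
    constructor
    · rintro _ ⟨i, ψ, hψ, rfl⟩
      obtain ⟨χ, hχ, h⟩ := ih.2 ψ hψ
      exact ⟨_, ⟨i, χ, hχ, rfl⟩, fun N E v => by simp [sat_all, sat_ex, h]⟩
    · rintro _ ⟨i, ψ, hψ, rfl⟩
      obtain ⟨χ, hχ, h⟩ := ih.1 ψ hψ
      exact ⟨_, ⟨i, χ, hχ, rfl⟩, fun N E v => by simp [sat_all, sat_ex, h]⟩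

end Renaming

/-- Prepend a value to a valuation. -/
def scons {N : Type} (a : N) (v : ℕ → N) : ℕ → N
  | 0 => a
  | k + 1 => v k

/-- Predicates on valuations, uniformly in the structure. -/
abbrev Pred : Type 1 := ∀ N : Type, (N → N → Prop) → (ℕ → N) → Prop

/-- Over structures in the class `K`, the predicate `P` is expressed by a Σ_n formula. -/
def SDef (K : ∀ N : Type, (N → N → Prop) → Prop) (n : ℕ) (P : Pred) : Prop :=
  ∃ φ, IsSigma n φ ∧ ∀ N E, K N E → ∀ v, Sat E v φ ↔ P N E v

namespace SDef

variable {K : ∀ N : Type, (N → N → Prop) → Prop} {n : ℕ} {P Q : Pred}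

theorem congr (h : SDef K n P) (hPQ : ∀ N E, K N E → ∀ v, P N E v ↔ Q N E v) : SDef K n Q := by
  obtain ⟨φ, hφ, h⟩ := h
  exact ⟨φ, hφ, fun N E hK v => (h N E hK v).trans (hPQ N E hK v)⟩

theorem of_sat {φ : Fml} (h : IsSigma n φ) : SDef K n (fun _ E v => Sat E v φ) :=
  ⟨φ, h, fun _ _ _ _ => Iff.rfl⟩

theorem of_not_sat {φ : Fml} (h : IsPi n φ) : SDef K n (fun _ E v => ¬ Sat E v φ) := by
  obtain ⟨ψ, hψ, h⟩ := (exists_dual n).2 φ h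
  exact ⟨ψ, hψ, fun _ _ _ _ => h _ _ _⟩

theorem exists_pi (h : SDef K n P) :
    ∃ φ, IsPi n φ ∧ ∀ N E, K N E → ∀ v, Sat E v φ ↔ ¬ P N E v := by
  obtain ⟨φ, hφ, h⟩ := h
  obtain ⟨ψ, hψ, h'⟩ := (exists_dual n).1 φ hφ
  exact ⟨ψ, hψ, fun N E hK v => by rw [h', h N E hK]⟩

theorem rename (h : SDef K n P) (ρ : ℕ → ℕ) : SDef K n (fun N E v => P N E (v ∘ ρ)) := by
  obtain ⟨φ, hφ, h⟩ := h
  exact ⟨φ.rename ρ, (levels_rename n).1 φ hφ ρ, fun N E hK v => by rw [sat_rename, h N E hK]⟩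

theorem exists_shift (φ : Fml) (j : ℕ) : ∃ m ρ, m ≠ j ∧
    ∀ (N : Type) (E : N → N → Prop) v a,
      Sat E (Function.update v m a) (φ.rename ρ) ↔ Sat E (scons a v) φ := by
  obtain ⟨m, hm⟩ := ((fv_finite φ).union (((fv_finite φ).image Nat.pred).union
    (Set.finite_singleton j))).exists_notMem
  simp only [Set.mem_union, not_or, Set.mem_singleton_iff] at hm
  refine ⟨m, fun k => if k = 0 then m else k - 1, hm.2.2, fun N E v a => ?_⟩
  rw [sat_rename]
  refine sat_congr _ _ _ _ fun k hk => ?_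
  rcases k with _ | k
  · simp [scons]
  · have : k ≠ m := fun h => hm.2.1 ⟨k + 1, hk, h⟩
    simp [scons, this]

theorem succ_iff : SDef K (n + 1) P ↔
    ∃ Q, SDef K n Q ∧ ∀ N E, K N E → ∀ v, P N E v ↔ ∃ a, ¬ Q N E (scons a v) := by
  constructor
  · rintro ⟨_, ⟨i, ψ, hψ, rfl⟩, h⟩
    refine ⟨_, (of_not_sat (K := K) hψ).rename (fun k => if k = i then 0 else k + 1),
      fun N E hK v => ?_⟩
    rw [← h N E hK v, sat_ex]
    refine exists_congr fun a => ?_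
    rw [not_not]
    refine iff_of_eq (congrArg (Sat E · ψ) ?_)
    funext k
    by_cases hk : k = i
    · subst hk; simp [scons]
    · simp [hk, scons]
  · rintro ⟨Q, hQ, h⟩
    obtain ⟨φ, hφ, hφQ⟩ := hQ.exists_pi
    obtain ⟨m, ρ, -, hm⟩ := exists_shift φ 0
    refine ⟨_, ⟨m, φ.rename ρ, (levels_rename n).2 φ hφ ρ, rfl⟩, fun N E hK v => ?_⟩
    rw [sat_ex, h N E hK v]
    exact exists_congr fun a => by rw [hm, hφQ N E hK]

theorem ex_not (h : SDef K n P) : SDef K (n + 1) (fun N E v => ∃ a, ¬ P N E (scons a v)) :=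
  succ_iff.2 ⟨P, h, fun _ _ _ _ => Iff.rfl⟩

theorem not_zero (h : SDef K 0 P) : SDef K 0 (fun N E v => ¬ P N E v) := by
  obtain ⟨φ, hφ, h⟩ := h
  exact ⟨φ.not, .not hφ, fun N E hK v => not_congr (h N E hK v)⟩

theorem not_succ (h : SDef K n P) : SDef K (n + 1) (fun N E v => ¬ P N E v) :=
  (h.rename Nat.succ).ex_not.congr fun _ _ _ v =>
    ⟨fun ⟨_, ha⟩ => ha, fun hv => ⟨v 0, hv⟩⟩

theorem succ (h : SDef K n P) : SDef K (n + 1) P := by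
  induction n generalizing P with
  | zero => exact h.not_zero.not_succ.congr fun _ _ _ _ => not_not
  | succ n ih =>
    obtain ⟨Q, hQ, hPQ⟩ := succ_iff.1 h
    exact succ_iff.2 ⟨Q, ih hQ, hPQ⟩

theorem mono {m : ℕ} (hmn : m ≤ n) (h : SDef K m P) : SDef K n P := by
  induction hmn with
  | refl => exact h
  | step _ ih => exact ih.succ

theorem exists_fv (h : SDef K n P) : ∃ φ, IsSigma n φ ∧ φ.fv ⊆ {0, 1, 2} ∧
    ∀ N E, K N E → ∀ x y w, Sat E (val3 x y w) φ ↔ P N E (val3 x y w) := by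
  obtain ⟨φ, hφ, h⟩ := h
  refine ⟨φ.rename (fun k => min k 2), (levels_rename n).1 φ hφ _,
    (fv_rename _ _).trans ?_, fun N E hK x y w => ?_⟩
  · rintro _ ⟨k, -, rfl⟩
    simp only [Set.mem_insert_iff, Set.mem_singleton_iff]
    omega
  · rw [sat_rename, h N E hK]
    refine iff_of_eq (congrArg (P N E) ?_)
    funext k
    rcases k with _ | _ | k
    · rfl
    · rfl
    · simp [val3]

theorem exists_support (h : SDef K n P) : ∃ r, ∀ N E, K N E → ∀ v w,
    (∀ k < r, v k = w k) → (P N E v ↔ P N E w) := by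
  obtain ⟨φ, hφ, h⟩ := h
  obtain ⟨r, hr⟩ := (fv_finite φ).bddAbove
  refine ⟨r + 1, fun N E hK v w hvw => ?_⟩
  rw [← h N E hK, ← h N E hK]
  exact sat_congr _ _ _ _ fun k hk => hvw k (Nat.lt_succ_of_le (hr hk))

theorem and_zero (hP : SDef K 0 P) (hQ : SDef K 0 Q) :
    SDef K 0 (fun N E v => P N E v ∧ Q N E v) := by
  obtain ⟨φ, hφ, h⟩ := hP
  obtain ⟨ψ, hψ, h'⟩ := hQ
  exact ⟨φ.and ψ, .and hφ hψ, fun N E hK v => and_congr (h N E hK v) (h' N E hK v)⟩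

theorem bex_zero (hP : SDef K 0 P) (j : ℕ) :
    SDef K 0 (fun N E v => ∃ a, E a (v j) ∧ P N E (scons a v)) := by
  obtain ⟨φ, hφ, h⟩ := hP
  obtain ⟨m, ρ, hmj, hm⟩ := exists_shift φ j
  refine ⟨_, .bex hmj (IsDelta0.rename hφ ρ), fun N E hK v => ?_⟩
  rw [sat_ex]
  refine exists_congr fun a => ?_
  rw [sat_and, sat_mem, hm, h N E hK, Function.update_self, Function.update_of_ne hmj.symm]

theorem isPairOf_zero (i j k : ℕ) : SDef K 0 (fun _ E v => IsPairOf E (v i) (v j) (v k)) := by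
  refine ⟨((Fml.mem j i).and (.mem k i)).and (.all (i + j + k + 1)
    ((Fml.mem (i + j + k + 1) i).imp ((Fml.eq (i + j + k + 1) j).or (.eq (i + j + k + 1) k)))),
    .and (.and (.mem _ _) (.mem _ _)) (.ball (by omega) (.or (.eq _ _) (.eq _ _))), ?_⟩
  intro N E _ v
  have hi : i ≠ i + j + k + 1 := by omega
  have hj : j ≠ i + j + k + 1 := by omega
  have hk : k ≠ i + j + k + 1 := by omega
  simp only [sat_and, sat_all, sat_imp, sat_or, sat_mem, sat_eq, Function.update_self,
    Function.update_of_ne hi, Function.update_of_ne hj, Function.update_of_ne hk, IsPairOf]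
  constructor
  · rintro ⟨⟨h₁, h₂⟩, h₃⟩ w
    exact ⟨h₃ w, by rintro (rfl | rfl) <;> assumption⟩
  · intro h
    exact ⟨⟨(h _).2 (Or.inl rfl), (h _).2 (Or.inr rfl)⟩, fun w => (h w).1⟩

end SDef

/-- Closure of the Σ_n-expressible predicates under positive connectives and bounded
quantifiers. -/
structure SClosed (K : ∀ N : Type, (N → N → Prop) → Prop) (n : ℕ) : Prop where
  and {P Q : Pred} : SDef K n P → SDef K n Q → SDef K n (fun N E v => P N E v ∧ Q N E v)
  or {P Q : Pred} : SDef K n P → SDef K n Q → SDef K n (fun N E v => P N E v ∨ Q N E v)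
  bex {P : Pred} : SDef K n P → ∀ j,
    SDef K n (fun N E v => ∃ a, E a (v j) ∧ P N E (scons a v))
  ball {P : Pred} : SDef K n P → ∀ j,
    SDef K n (fun N E v => ∀ a, E a (v j) → P N E (scons a v))

theorem sClosed_zero (K : ∀ N : Type, (N → N → Prop) → Prop) : SClosed K 0 where
  and hP hQ := hP.and_zero hQ
  or hP hQ := (hP.not_zero.and_zero hQ.not_zero).not_zero.congr fun _ _ _ _ => by tauto
  bex hP j := hP.bex_zero j
  ball hP j := (hP.not_zero.bex_zero j).not_zero.congr fun _ _ _ _ => by simp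

section

variable {K : ∀ N : Type, (N → N → Prop) → Prop} {n : ℕ} {P Q : Pred}

theorem SClosed.or_succ (hC : SClosed K n) (hP : SDef K (n + 1) P) (hQ : SDef K (n + 1) Q) :
    SDef K (n + 1) (fun N E v => P N E v ∨ Q N E v) := by
  obtain ⟨P', hP', hP⟩ := SDef.succ_iff.1 hP
  obtain ⟨Q', hQ', hQ⟩ := SDef.succ_iff.1 hQ
  refine (hC.and hP' hQ').ex_not.congr fun N E hK v => ?_
  rw [hP N E hK, hQ N E hK, ← exists_or]
  exact exists_congr fun a => by tauto

/-- The valuation `b, a, v` as a renaming of `b, a, z, v`. -/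
theorem scons_scons_comp {N : Type} (a b z : N) (v : ℕ → N) :
    (scons b (scons a (scons z v)) ∘ fun k => if k < 2 then k else k + 1) =
      scons b (scons a v) := by
  funext k
  rcases k with _ | _ | k <;> simp [scons]

theorem scons_comp {N : Type} (a z : N) (v : ℕ → N) :
    (scons a (scons z v) ∘ fun k => if k < 1 then k else k + 1) = scons a v := by
  funext k
  rcases k with _ | k <;> simp [scons]

theorem scons_swap {N : Type} (a b : N) (v : ℕ → N) :
    (scons a (scons b v) ∘ fun k => if k = 0 then 1 else if k = 1 then 0 else k) =
      scons b (scons a v) := by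
  funext k
  rcases k with _ | _ | k <;> simp [scons]

theorem SClosed.and_succ (hK : ∀ N E, K N E → SatDB0 E) (hC : SClosed K n)
    (hP : SDef K (n + 1) P) (hQ : SDef K (n + 1) Q) :
    SDef K (n + 1) (fun N E v => P N E v ∧ Q N E v) := by
  obtain ⟨P', hP', hP⟩ := SDef.succ_iff.1 hP
  obtain ⟨Q', hQ', hQ⟩ := SDef.succ_iff.1 hQ
  refine (hC.or (hC.ball (hP'.rename (fun k => if k < 1 then k else k + 1)) 0)
    (hC.ball (hQ'.rename (fun k => if k < 1 then k else k + 1)) 0)).ex_not.congr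
    fun N E hKN v => ?_
  rw [hP N E hKN, hQ N E hKN]
  simp only [scons_comp]
  constructor
  · rintro ⟨z, hz⟩
    simp only [not_or, not_forall] at hz
    obtain ⟨⟨a, -, ha⟩, b, -, hb⟩ := hz
    exact ⟨⟨a, ha⟩, b, hb⟩
  · rintro ⟨⟨a, ha⟩, b, hb⟩
    obtain ⟨z, hz⟩ := (hK N E hKN).2.2.1 a b
    refine ⟨z, ?_⟩
    simp only [not_or, not_forall]
    exact ⟨⟨a, (hz a).2 (Or.inl rfl), ha⟩, b, (hz b).2 (Or.inr rfl), hb⟩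

theorem SClosed.ex_succ (hK : ∀ N E, K N E → SatDB0 E) (hC : SClosed K n)
    (hP : SDef K (n + 1) P) :
    SDef K (n + 1) (fun N E v => ∃ a, P N E (scons a v)) := by
  obtain ⟨P', hP', hP⟩ := SDef.succ_iff.1 hP
  refine (hC.ball (hC.ball (hP'.rename (fun k => if k < 2 then k else k + 1)) 1) 0).ex_not.congr
    fun N E hKN v => ?_
  simp only [hP N E hKN]
  simp only [scons_scons_comp]
  constructor
  · rintro ⟨z, hz⟩
    simp only [not_forall] at hz
    obtain ⟨a, -, b, -, hb⟩ := hz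
    exact ⟨a, b, hb⟩
  · rintro ⟨a, b, hb⟩
    obtain ⟨z, hz⟩ := (hK N E hKN).2.2.1 a b
    refine ⟨z, ?_⟩
    simp only [not_forall]
    exact ⟨a, (hz a).2 (Or.inl rfl), b, (hz b).2 (Or.inr rfl), hb⟩

theorem SClosed.bex_succ (hC : SClosed K n) (hP : SDef K (n + 1) P) (j : ℕ) :
    SDef K (n + 1) (fun N E v => ∃ a, E a (v j) ∧ P N E (scons a v)) := by
  obtain ⟨P', hP', hP⟩ := SDef.succ_iff.1 hP
  refine (hC.ball (hP'.rename (fun k => if k = 0 then 1 else if k = 1 then 0 else k))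
    (j + 1)).ex_not.congr fun N E hKN v => ?_
  simp only [hP N E hKN]
  simp only [scons_swap, not_forall]
  constructor
  · rintro ⟨b, a, ha, h⟩
    exact ⟨a, ha, b, h⟩
  · rintro ⟨a, ha, b, h⟩
    exact ⟨b, a, ha, h⟩

end

theorem IsOPairOf.inj {N : Type} {E : N → N → Prop} {z a b c d : N} (h : IsOPairOf E z a b)
    (h' : IsOPairOf E z c d) : a = c ∧ b = d := by
  obtain ⟨s, t, hs, ht, hz⟩ := h
  obtain ⟨s', t', hs', ht', hz'⟩ := h'
  unfold IsPairOf at *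
  have hac : a = c := by
    rcases (hz s').1 ((hz' s').2 (Or.inl rfl)) with rfl | rfl
    · simpa using (hs' a).1 ((hs a).2 (Or.inl rfl))
    · simpa using (hs' a).1 ((ht a).2 (Or.inl rfl))
  subst hac
  have h₁ : t' = s ∨ t' = t := (hz t').1 ((hz' t').2 (Or.inr rfl))
  have h₂ : t = s' ∨ t = t' := (hz' t).1 ((hz t).2 (Or.inr rfl))
  have hb := (ht b).2 (Or.inr rfl)
  have hd := (ht' d).2 (Or.inr rfl)
  refine ⟨rfl, ?_⟩
  rcases h₁ with rfl | rfl
  · have hda : d = a := by simpa using (hs d).1 hd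
    rcases h₂ with rfl | rfl
    · have hba : b = a := by simpa using (hs' b).1 hb
      rw [hba, hda]
    · have hba : b = a := by simpa using (hs b).1 hb
      rw [hba, hda]
  · rcases (ht' b).1 hb with hba | hbd
    · rcases (ht d).1 hd with hda | hdb
      · rw [hba, hda]
      · exact hdb.symm
    · exact hbd

/-- `S` contains an ordered pair of any two of its elements. -/
def PairClosed {N : Type} (E : N → N → Prop) (S : Set N) : Prop :=
  ∀ a ∈ S, ∀ b ∈ S, ∃ z ∈ S, IsOPairOf E z a b

theorem SatDB0.pairClosed_univ {N : Type} {E : N → N → Prop} (h : SatDB0 E) :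
    PairClosed E Set.univ := by
  intro a _ b _
  obtain ⟨s, hs⟩ := h.2.2.1 a a
  obtain ⟨t, ht⟩ := h.2.2.1 a b
  obtain ⟨z, hz⟩ := h.2.2.1 s t
  exact ⟨z, trivial, s, t, hs, ht, hz⟩

section

variable {K : ∀ N : Type, (N → N → Prop) → Prop} {n : ℕ} {P Q : Pred}

/-- Replace the parameters in places 2 and 3 by a single place holding their ordered pair. -/
theorem SClosed.exists_merge (hC : SClosed K n) (hQ : SDef K n Q) : ∃ Q', SDef K n Q' ∧
    ∀ N E, K N E → ∀ u, Q' N E u ↔ ∃ a b, IsOPairOf E (u 2) a b ∧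
      Q N E (scons (u 0) (scons (u 1) (scons a (scons b fun k => u (k + 3))))) := by
  have key := hC.bex (hC.bex (hC.bex (hC.bex
    (hC.and (hC.and ((SDef.isPairOf_zero (K := K) 3 1 1).mono (Nat.zero_le n))
        ((SDef.isPairOf_zero 2 1 0).mono (Nat.zero_le n)))
      (hC.and ((SDef.isPairOf_zero 6 3 2).mono (Nat.zero_le n))
        (hQ.rename fun k => if k = 0 then 4 else if k = 1 then 5 else if k = 2 then 1 else
          if k = 3 then 0 else k + 3)))
    1) 1) 3) 2
  refine ⟨_, key, fun N E hK u => ?_⟩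
  have hcomp : ∀ a b s t : N, (scons b (scons a (scons t (scons s u))) ∘
      fun k => if k = 0 then 4 else if k = 1 then 5 else if k = 2 then 1 else
          if k = 3 then 0 else k + 3) =
      scons (u 0) (scons (u 1) (scons a (scons b fun k => u (k + 3)))) := by
    intro a b s t
    funext k
    rcases k with _ | _ | _ | _ | k <;> simp [scons]
  simp only [hcomp]
  simp only [scons]
  constructor
  · rintro ⟨s, -, t, -, a, -, b, -, ⟨hs, ht⟩, hz, h⟩
    exact ⟨a, b, ⟨s, t, hs, ht, hz⟩, h⟩
  · rintro ⟨a, b, ⟨s, t, hs, ht, hz⟩, h⟩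
    exact ⟨s, (hz s).2 (Or.inl rfl), t, (hz t).2 (Or.inr rfl), a, (hs a).2 (Or.inl rfl),
      b, (ht b).2 (Or.inr rfl), ⟨hs, ht⟩, hz, h⟩

/-- All parameters of a Σ_n predicate can be coded by a single one. -/
theorem SClosed.exists_code (hC : SClosed K n) (hQ : SDef K n Q) : ∃ Q', SDef K n Q' ∧
    ∀ N E, K N E → ∀ S : Set N, PairClosed E S → ∀ v : ℕ → N, (∀ k, v k ∈ S) →
      ∃ w ∈ S, ∀ x y, Q' N E (val3 x y w) ↔ Q N E (scons x (scons y v)) := by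
  obtain ⟨r, hr⟩ := hQ.exists_support
  replace hr : ∀ N E, K N E → ∀ v w, (∀ k < r + 3, v k = w k) → (Q N E v ↔ Q N E w) :=
    fun N E hK v w h => hr N E hK v w fun k hk => h k (by omega)
  induction r generalizing Q with
  | zero =>
    refine ⟨Q, hQ, fun N E hK S _ v hv => ⟨v 0, hv 0, fun x y => hr N E hK _ _ ?_⟩⟩
    intro k hk
    rcases k with _ | _ | _ | k
    · rfl
    · rfl
    · rfl
    · omega
  | succ r ih =>
    obtain ⟨Q₁, hQ₁, h₁⟩ := hC.exists_merge hQ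
    obtain ⟨Q', hQ', h'⟩ := ih hQ₁ fun N E hK v w hvw => by
      rw [h₁ N E hK, h₁ N E hK, hvw 2 (by omega), hvw 0 (by omega), hvw 1 (by omega)]
      refine exists₂_congr fun a b => and_congr_right fun _ => hr N E hK _ _ fun k hk => ?_
      rcases k with _ | _ | _ | _ | k
      · rfl
      · rfl
      · rfl
      · rfl
      · exact hvw (k + 3) (by omega)
    refine ⟨Q', hQ', fun N E hK S hS v hv => ?_⟩
    obtain ⟨z, hzS, hz⟩ := hS _ (hv 0) _ (hv 1)
    obtain ⟨w, hwS, hw⟩ := h' N E hK S hS (scons z fun k => v (k + 2)) fun k => by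
      rcases k with _ | k
      · exact hzS
      · exact hv (k + 2)
    refine ⟨w, hwS, fun x y => ?_⟩
    rw [hw, h₁ N E hK]
    have hv' : ∀ a b, a = v 0 → b = v 1 →
        scons x (scons y (scons a (scons b fun k => v (k + 2)))) = scons x (scons y v) := by
      rintro _ _ rfl rfl
      funext k
      rcases k with _ | _ | _ | _ | k <;> rfl
    constructor
    · rintro ⟨a, b, hab, h⟩
      obtain ⟨ha, hb⟩ := hab.inj hz
      rwa [← hv' a b ha hb]
    · intro h
      refine ⟨v 0, v 1, hz, ?_⟩
      rwa [← hv' _ _ rfl rfl] at h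

theorem SClosed.collection (hK : ∀ N E, K N E → SatDB0 E)
    (hcoll : ∀ N E, K N E → CollScheme E (IsSigma (n + 1))) (hC : SClosed K n)
    (hQ : SDef K n Q) {N : Type} {E : N → N → Prop} (hKN : K N E) (v : ℕ → N) (p : N)
    (h : ∀ a, E a p → ∃ b, ¬ Q N E (scons b (scons a v))) :
    ∃ q, ∀ a, E a p → ∃ b, E b q ∧ ¬ Q N E (scons b (scons a v)) := by
  obtain ⟨Q', hQ', h'⟩ :=
    hC.exists_code (hQ.rename fun k => if k = 0 then 1 else if k = 1 then 0 else k)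
  simp only [scons_swap] at h'
  obtain ⟨φ, hφ, hfv, hφQ⟩ := hQ'.not_succ.exists_fv
  obtain ⟨w, -, hw⟩ := h' N E hKN _ (hK N E hKN).pairClosed_univ v fun _ => trivial
  have := hcoll N E hKN φ hφ hfv w p
  simp only [hφQ N E hKN, hw] at this
  exact this h

theorem SClosed.succ (hK : ∀ N E, K N E → SatDB0 E)
    (hcoll : ∀ N E, K N E → CollScheme E (IsSigma (n + 1))) (hC : SClosed K n) :
    SClosed K (n + 1) where
  and hP hQ := hC.and_succ hK hP hQ
  or hP hQ := hC.or_succ hP hQ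
  bex hP j := hC.bex_succ hP j
  ball {P} hP j := by
    obtain ⟨P', hP', hP⟩ := SDef.succ_iff.1 hP
    refine (hC.bex (hC.ball (hP'.rename (fun k => if k < 2 then k else k + 1)) 1)
      (j + 1)).ex_not.congr fun N E hKN v => ?_
    simp only [hP N E hKN]
    simp only [scons_scons_comp]
    constructor
    · rintro ⟨q, hq⟩ a ha
      simp only [not_exists, not_and, not_forall] at hq
      obtain ⟨b, -, hb⟩ := hq a ha
      exact ⟨b, hb⟩
    · intro h
      obtain ⟨q, hq⟩ := hC.collection hK hcoll hP' hKN v (v j) h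
      refine ⟨q, ?_⟩
      simp only [not_exists, not_and, not_forall]
      intro a ha
      obtain ⟨b, hbq, hb⟩ := hq a ha
      exact ⟨b, hbq, hb⟩

end

theorem CollScheme.of_succ {N : Type} {E : N → N → Prop} {n : ℕ}
    (h : CollScheme E (IsSigma (n + 1))) : CollScheme E (IsSigma n) := by
  intro φ hφ _ v p
  obtain ⟨ψ, hψ, hfv, hψφ⟩ := (SDef.of_sat (K := fun _ _ => True) hφ).succ.exists_fv
  have := h ψ hψ hfv v p
  simpa only [hψφ N E trivial] using this

theorem CollSScheme.collScheme {N : Type} {E : N → N → Prop} {Γ : Fml → Prop}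
    (h : CollSScheme E Γ) : CollScheme E Γ := by
  intro φ hφ hfv v p hp
  obtain ⟨q, hq⟩ := h φ hφ hfv v p
  exact ⟨q, fun x hx => (hq x hx).1 (hp x hx)⟩

/-- Models of DB₀, together with Σ_n-collection if `n` is positive. -/
def DB0Coll (n : ℕ) (N : Type) (E : N → N → Prop) : Prop :=
  SatDB0 E ∧ (n ≠ 0 → CollScheme E (IsSigma n))

theorem sClosed_of_dB0Coll {K : ∀ N : Type, (N → N → Prop) → Prop} {n : ℕ}
    (hK : ∀ N E, K N E → DB0Coll n N E) : SClosed K n := by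
  induction n with
  | zero => exact sClosed_zero K
  | succ n ih =>
    have hcoll := fun N E h => (hK N E h).2 n.succ_ne_zero
    exact (ih fun N E h => ⟨(hK N E h).1, fun _ => (hcoll N E h).of_succ⟩).succ
      (fun N E h => (hK N E h).1) hcoll

section Hull

variable {M N : Type} {EM : M → M → Prop} {EN : N → N → Prop} {f : M → N} {n : ℕ}

theorem SigmaElemEmb.transfer {K : ∀ N : Type, (N → N → Prop) → Prop} {P : Pred}
    (h : SigmaElemEmb n EM EN f) (hP : SDef K n P) (hM : K M EM) (hN : K N EN) (v : ℕ → M) :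
    P M EM v ↔ P N EN (f ∘ v) := by
  obtain ⟨φ, hφ, hφP⟩ := hP
  rw [← hφP M EM hM, ← hφP N EN hN, h φ hφ]

theorem comp_scons (a : M) (v : ℕ → M) : f ∘ scons a v = scons (f a) (f ∘ v) := by
  funext k
  rcases k with _ | k <;> rfl

theorem mem_hull (hM : SatDB0 EM) (hf : SubStr EM EN f) (m : M) : f m ∈ hull EN f := by
  obtain ⟨p, hp⟩ := hM.2.2.1 m m
  exact ⟨p, (hf.2 _ _).1 ((hp m).2 (Or.inl rfl))⟩

theorem mem_hull_of_mem (hM : SatDB0 EM) (h : SigmaElemEmb n EM EN f) {a b : N}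
    (ha : a ∈ hull EN f) (hb : EN b a) : b ∈ hull EN f := by
  obtain ⟨m, hm⟩ := ha
  obtain ⟨u, hu⟩ := hM.2.2.2.1 m
  have hC := sClosed_zero fun _ _ => True
  have hP := (hC.ball (hC.ball (SDef.of_sat (n := 0) (IsDelta0.mem 0 3)) 0) 0).mono
    (Nat.zero_le n)
  exact ⟨u, (h.transfer hP trivial trivial (scons m fun _ => u)).1
    (fun y hy x hx => (hu x).2 ⟨y, hy, hx⟩) a hm b hb⟩

theorem pairClosed_hull (hM : SatDB0 EM) (h : SigmaElemEmb n EM EN f) :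
    PairClosed EN (hull EN f) := by
  rintro a ⟨m, hm⟩ b ⟨m', hm'⟩
  obtain ⟨c, hc⟩ := hM.2.2.2.2.1 m m'
  have hC := sClosed_zero fun _ _ => True
  have hP := (hC.ball (hC.ball (hC.bex (hC.bex (hC.bex
    (hC.and (SDef.isPairOf_zero 1 4 4) (hC.and (SDef.isPairOf_zero 0 4 3)
      (SDef.isPairOf_zero 2 1 0))) 1) 0) 4) 2) 0).mono (Nat.zero_le n)
  obtain ⟨z, hz, s, -, t, -, hs, ht, hst⟩ :=
    (h.transfer hP trivial trivial (scons m (scons m' fun _ => c))).1 (by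
      intro a ha b hb
      obtain ⟨s, hs⟩ := hM.2.2.1 a a
      obtain ⟨t, ht⟩ := hM.2.2.1 a b
      obtain ⟨z, hz⟩ := hM.2.2.1 s t
      exact ⟨z, (hc z).2 ⟨a, b, ha, hb, s, t, hs, ht, hz⟩, s, (hz s).2 (Or.inl rfl),
        t, (hz t).2 (Or.inr rfl), hs, ht, hz⟩) a hm b hm'
  exact ⟨z, ⟨c, hz⟩, s, t, hs, ht, hst⟩

theorem forall_update_mem {S : Set N} {v : ℕ → N} (hv : ∀ k, v k ∈ S) (i : ℕ) {a : N}
    (ha : a ∈ S) (k : ℕ) : Function.update v i a k ∈ S := by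
  by_cases hk : k = i
  · subst hk; simpa using ha
  · simpa [hk] using hv k

/-- Δ₀ formulas are absolute for transitive substructures. -/
theorem IsDelta0.satIn_iff {S : Set N} (hS : ∀ a ∈ S, ∀ b, EN b a → b ∈ S) {φ : Fml}
    (hφ : IsDelta0 φ) (v : ℕ → N) (hv : ∀ k, v k ∈ S) : SatIn EN S v φ ↔ Sat EN v φ := by
  induction hφ generalizing v with
  | mem i j => exact Iff.rfl
  | eq i j => exact Iff.rfl
  | not _ ih => exact not_congr (ih v hv)
  | and _ _ ih₁ ih₂ => exact and_congr (ih₁ v hv) (ih₂ v hv)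
  | or _ _ ih₁ ih₂ => exact or_congr (ih₁ v hv) (ih₂ v hv)
  | imp _ _ ih₁ ih₂ => exact imp_congr (ih₁ v hv) (ih₂ v hv)
  | @ball i j φ hij _ ih =>
    simp only [sat_all, sat_imp, sat_mem, SatIn, Function.update_self,
      Function.update_of_ne hij.symm]
    constructor
    · intro h a ha
      have haS := hS _ (hv j) a ha
      exact (ih _ (forall_update_mem hv i haS)).1 (h a haS ha)
    · intro h a haS ha
      exact (ih _ (forall_update_mem hv i haS)).2 (h a ha)
  | @bex i j φ hij _ ih =>
    simp only [sat_ex, sat_and, sat_mem, SatIn, Function.update_self,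
      Function.update_of_ne hij.symm]
    constructor
    · rintro ⟨a, haS, ha, h⟩
      exact ⟨a, ha, (ih _ (forall_update_mem hv i haS)).1 h⟩
    · rintro ⟨a, ha, h⟩
      have haS := hS _ (hv j) a ha
      exact ⟨a, haS, ha, (ih _ (forall_update_mem hv i haS)).2 h⟩

theorem update_eq_scons_comp (v : ℕ → N) (i : ℕ) (a : N) :
    Function.update v i a = scons a v ∘ fun k => if k = i then 0 else k + 1 := by
  funext k
  by_cases hk : k = i
  · subst hk; simp [scons]
  · simp [hk, scons]

/-- Tarski–Vaught criterion for Σ_{n+1}-elementarity. -/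
theorem levels_satIn_iff {K : ∀ N : Type, (N → N → Prop) → Prop} {S : Set N}
    (hS : ∀ a ∈ S, ∀ b, EN b a → b ∈ S)
    (hTV : ∀ Q, SDef K n Q → ∀ v : ℕ → N, (∀ k, v k ∈ S) →
      (∃ a, ¬ Q N EN (scons a v)) → ∃ a ∈ S, ¬ Q N EN (scons a v))
    {k : ℕ} (hk : k ≤ n + 1) :
    (∀ φ, IsSigma k φ → ∀ v : ℕ → N, (∀ k, v k ∈ S) → (SatIn EN S v φ ↔ Sat EN v φ)) ∧
    (∀ φ, IsPi k φ → ∀ v : ℕ → N, (∀ k, v k ∈ S) → (SatIn EN S v φ ↔ Sat EN v φ)) := by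
  induction k with
  | zero => exact ⟨fun φ hφ v hv => IsDelta0.satIn_iff hS hφ v hv,
      fun φ hφ v hv => IsDelta0.satIn_iff hS hφ v hv⟩
  | succ k ih =>
    obtain ⟨ih₁, ih₂⟩ := ih (by omega)
    constructor
    · rintro _ ⟨i, ψ, hψ, rfl⟩ v hv
      rw [sat_ex]
      constructor
      · rintro ⟨a, ha, h⟩
        exact ⟨a, (ih₂ ψ hψ _ (forall_update_mem hv i ha)).1 h⟩
      · rintro ⟨a, h⟩
        obtain ⟨b, hb, h⟩ := hTV _ (((SDef.of_not_sat hψ).mono (by omega)).rename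
          fun k => if k = i then 0 else k + 1) v hv
          ⟨a, by rw [← update_eq_scons_comp]; exact not_not.2 h⟩
        rw [← update_eq_scons_comp, not_not] at h
        exact ⟨b, hb, (ih₂ ψ hψ _ (forall_update_mem hv i hb)).2 h⟩
    · rintro _ ⟨i, ψ, hψ, rfl⟩ v hv
      rw [sat_all]
      constructor
      · intro h
        by_contra hcon
        obtain ⟨a, ha⟩ := not_forall.1 hcon
        obtain ⟨b, hb, hb'⟩ := hTV _ (((SDef.of_sat hψ).mono (by omega)).rename
          fun k => if k = i then 0 else k + 1) v hv
          ⟨a, by rw [← update_eq_scons_comp]; exact ha⟩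
        rw [← update_eq_scons_comp] at hb'
        exact hb' ((ih₁ ψ hψ _ (forall_update_mem hv i hb)).1 (h b hb))
      · intro h a ha
        exact (ih₁ ψ hψ _ (forall_update_mem hv i ha)).2 (h a)

/-- Strong Σ_{n+1}-collection lets Σ_{n+1} witnesses be found in the hull. -/
theorem CollSScheme.sigmaElemInTop (hM : DB0Coll n M EM) (hN : DB0Coll n N EN)
    (hcoll : CollSScheme EM (IsSigma (n + 1))) (h : SigmaElemEmb (n + 1) EM EN f) :
    SigmaElemInTop (n + 1) EN (hull EN f) := by
  have hC : SClosed (DB0Coll n) n := sClosed_of_dB0Coll fun _ _ h => h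
  have hK : ∀ N E, DB0Coll n N E → SatDB0 E := fun _ _ h => h.1
  refine (levels_satIn_iff (K := DB0Coll n) (fun a ha b hb => mem_hull_of_mem hM.1 h ha hb) ?_ le_rfl).1
  intro Q hQ v hv hex
  obtain ⟨R, hR, hRQ⟩ := hC.exists_code (hQ.rename fun k => if k = 0 then 1 else k + 1)
  have hcomp : ∀ (N : Type) (x y : N) (v : ℕ → N),
      (scons x (scons y v) ∘ fun k => if k = 0 then 1 else k + 1) = scons y v := by
    intro N x y v
    funext k
    rcases k with _ | k <;> rfl
  simp only [hcomp] at hRQ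
  obtain ⟨w, ⟨p, hwp⟩, hw⟩ := hRQ N EN hN _ (pairClosed_hull hM.1 h) v hv
  obtain ⟨φ, hφ, hfv, hφR⟩ :=
    (hR.rename fun k => if k < 2 then 1 else 0).not_succ.exists_fv
  have hval : ∀ (N : Type) (x y w : N),
      (val3 x y w ∘ fun k => if k < 2 then 1 else 0) = val3 y y x := by
    intro N x y w
    funext k
    rcases k with _ | _ | k <;> rfl
  simp only [hval] at hφR
  obtain ⟨q, hq⟩ := hcoll φ hφ hfv p p
  simp only [hφR M EM hM] at hq
  have hT := hC.bex_succ (hC.ex_succ hK (hC.and_succ hK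
    (hR.rename fun k => if k < 2 then 0 else 1).not_succ
    (hC.ball (hR.rename fun k => if k < 2 then 0 else 2) 3).succ)) 0
  have hval₁ : ∀ (N : Type) (x y : N) (v : ℕ → N),
      (scons y (scons x v) ∘ fun k => if k < 2 then 0 else 1) = val3 y y x := by
    intro N x y v
    funext k
    rcases k with _ | _ | k <;> rfl
  have hval₂ : ∀ (N : Type) (x y z : N) (v : ℕ → N),
      (scons z (scons y (scons x v)) ∘ fun k => if k < 2 then 0 else 2) = val3 z z x := by
    intro N x y z v
    funext k
    rcases k with _ | _ | k <;> rfl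
  have hiff := h.transfer hT hM hN (scons p fun _ => q)
  simp only [hval₁, hval₂] at hiff
  simp only [comp_scons, scons] at hiff
  have hno := mt hiff.2 (by
    rintro ⟨x, hx, y, hy, hall⟩
    obtain ⟨y', hy', hy'R⟩ := (hq x hx).1 ⟨y, hy⟩
    exact hy'R (hall y' hy'))
  obtain ⟨y, hy⟩ := hex
  simp only [not_exists, not_and, not_forall] at hno
  obtain ⟨y', hy', hy'R⟩ := hno w hwp y (by rwa [hw])
  exact ⟨y', ⟨q, hy'⟩, by rwa [hw] at hy'R⟩

end Hull

section Transfer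

variable {M N : Type} {EM : M → M → Prop} {EN : N → N → Prop} {f : M → N}

/-- A property of structures expressed by a single formula. -/
def FirstOrder (P : ∀ N : Type, (N → N → Prop) → Prop) : Prop :=
  ∃ φ, ∀ N E (v : ℕ → N), Sat E v φ ↔ P N E

theorem ElemEmb.transfer (h : ElemEmb EM EN f) {P : ∀ N : Type, (N → N → Prop) → Prop}
    (hP : FirstOrder P) [Nonempty M] (hM : P M EM) : P N EN := by
  obtain ⟨φ, hφ⟩ := hP
  have v : ℕ → M := fun _ => Classical.arbitrary M
  exact (hφ N EN _).1 ((h φ v).1 ((hφ M EM v).2 hM))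

theorem ElemEmb.sigmaElemEmb (h : ElemEmb EM EN f) (n : ℕ) : SigmaElemEmb n EM EN f :=
  fun φ _ v => h φ v

theorem ElemEmb.subStr (h : ElemEmb EM EN f) : SubStr EM EN f := by
  refine ⟨fun a b hab => ?_, fun a b => h (.mem 0 1) (scons a fun _ => b)⟩
  exact (h (.eq 0 1) (scons a fun _ => b)).2 hab

theorem firstOrder_ext : FirstOrder fun N E => ∀ a b : N, (∀ x, E x a ↔ E x b) → a = b :=
  ⟨.all 0 (.all 1 (.imp (.all 2 (.and (.imp (.mem 2 0) (.mem 2 1)) (.imp (.mem 2 1) (.mem 2 0))))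
    (.eq 0 1))), fun N E v => by
      simp [sat_all, sat_imp, sat_and, sat_mem, sat_eq,
        iff_iff_implies_and_implies]⟩

theorem firstOrder_empty : FirstOrder fun N E => ∃ e : N, ∀ x, ¬ E x e :=
  ⟨.ex 0 (.all 1 (.not (.mem 1 0))), fun N E v => by
    simp [sat_all, sat_ex, sat_not, sat_mem]⟩

theorem firstOrder_pair : FirstOrder fun N E => ∀ a b : N, ∃ p, IsPairOf E p a b := by
  obtain ⟨φ, -, h⟩ := SDef.isPairOf_zero (K := fun _ _ => True) 2 0 1
  exact ⟨.all 0 (.all 1 (.ex 2 φ)), fun N E v => by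
    simp [sat_all, sat_ex, h]⟩

theorem firstOrder_union :
    FirstOrder fun N E => ∀ a : N, ∃ u, ∀ x, E x u ↔ ∃ y, E y a ∧ E x y :=
  ⟨.all 0 (.ex 1 (.all 2 (.and (.imp (.mem 2 1) (.ex 3 (.and (.mem 3 0) (.mem 2 3))))
    (.imp (.ex 3 (.and (.mem 3 0) (.mem 2 3))) (.mem 2 1))))), fun N E v => by
      simp only [sat_all, sat_ex, sat_imp, sat_and, sat_mem, iff_iff_implies_and_implies]
      simp⟩

theorem firstOrder_prod : FirstOrder fun N E => ∀ a b : N, ∃ c, ∀ z, E z c ↔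
    ∃ x y, E x a ∧ E y b ∧ IsOPairOf E z x y := by
  obtain ⟨φ₁, -, h₁⟩ := SDef.isPairOf_zero (K := fun _ _ => True) 6 4 4
  obtain ⟨φ₂, -, h₂⟩ := SDef.isPairOf_zero (K := fun _ _ => True) 7 4 5
  obtain ⟨φ₃, -, h₃⟩ := SDef.isPairOf_zero (K := fun _ _ => True) 3 6 7
  exact ⟨.all 0 (.all 1 (.ex 2 (.all 3 (.and
    (.imp (.mem 3 2) (.ex 4 (.ex 5 (.and (.mem 4 0) (.and (.mem 5 1)
      (.ex 6 (.ex 7 (.and φ₁ (.and φ₂ φ₃)))))))))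
    (.imp (.ex 4 (.ex 5 (.and (.mem 4 0) (.and (.mem 5 1)
      (.ex 6 (.ex 7 (.and φ₁ (.and φ₂ φ₃)))))))) (.mem 3 2)))))), fun N E v => by
    simp only [sat_all, sat_ex, sat_imp, sat_and, sat_mem, iff_iff_implies_and_implies,
      h₁ N E trivial, h₂ N E trivial, h₃ N E trivial, IsOPairOf]
    simp⟩

theorem firstOrder_sepAx {φ : Fml} (hφ : φ.fv ⊆ {0, 1}) :
    FirstOrder fun _ E => SepAx E φ := by
  refine ⟨.all 1 (.all 2 (.ex 3 (.all 0 (.and (.imp (.mem 0 3) (.and (.mem 0 2) φ))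
    (.imp (.and (.mem 0 2) φ) (.mem 0 3)))))), fun N E v => ?_⟩
  have h : ∀ a p q x, Sat E (Function.update (Function.update (Function.update
      (Function.update v 1 a) 2 p) 3 q) 0 x) φ ↔ Sat E (val2 x a) φ := by
    intro a p q x
    refine sat_congr _ _ _ _ fun k hk => ?_
    rcases hφ hk with rfl | rfl <;> simp [val2]
  simp only [sat_all, sat_ex, sat_imp, sat_and, sat_mem, SepAx, iff_iff_implies_and_implies, h]
  simp

theorem firstOrder_collAx {φ : Fml} (hφ : φ.fv ⊆ {0, 1, 2}) :
    FirstOrder fun _ E => CollAx E φ := by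
  refine ⟨.all 2 (.all 3 (.imp (.all 0 (.imp (.mem 0 3) (.ex 1 φ)))
    (.ex 4 (.all 0 (.imp (.mem 0 3) (.ex 1 (.and (.mem 1 4) φ))))))), fun N E v => ?_⟩
  have h₁ : ∀ a p x y, Sat E (Function.update (Function.update (Function.update
      (Function.update v 2 a) 3 p) 0 x) 1 y) φ ↔ Sat E (val3 x y a) φ := by
    intro a p x y
    refine sat_congr _ _ _ _ fun k hk => ?_
    rcases hφ hk with rfl | rfl | rfl <;> simp [val3]
  have h₂ : ∀ a p q x y, Sat E (Function.update (Function.update (Function.update (Function.update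
      (Function.update v 2 a) 3 p) 4 q) 0 x) 1 y) φ ↔ Sat E (val3 x y a) φ := by
    intro a p q x y
    refine sat_congr _ _ _ _ fun k hk => ?_
    rcases hφ hk with rfl | rfl | rfl <;> simp [val3]
  simp only [sat_all, sat_ex, sat_imp, sat_and, sat_mem, CollAx, h₁, h₂]
  simp

theorem SatDB0.of_elemEmb (hM : SatDB0 EM) (h : ElemEmb EM EN f) : SatDB0 EN := by
  obtain ⟨h₁, h₂, h₃, h₄, h₅, h₆⟩ := hM
  have : Nonempty M := h₂.nonempty
  exact ⟨h.transfer firstOrder_ext h₁, h.transfer firstOrder_empty h₂,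
    h.transfer firstOrder_pair h₃, h.transfer firstOrder_union h₄,
    h.transfer firstOrder_prod h₅,
    fun φ hφ hfv => h.transfer (firstOrder_sepAx hfv) (h₆ φ hφ hfv)⟩

theorem CollScheme.of_elemEmb [Nonempty M] {Γ : Fml → Prop} (hM : CollScheme EM Γ)
    (h : ElemEmb EM EN f) : CollScheme EN Γ :=
  fun φ hφ hfv => h.transfer (firstOrder_collAx hfv) (hM φ hφ hfv)

theorem SatDB0.nonempty (hM : SatDB0 EM) : Nonempty M := hM.2.1.nonempty

theorem DB0Coll.of_elemEmb {n : ℕ} (hM : DB0Coll n M EM) (h : ElemEmb EM EN f) :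
    DB0Coll n N EN :=
  have := hM.1.nonempty
  ⟨hM.1.of_elemEmb h, fun hn => (hM.2 hn).of_elemEmb h⟩

/-- Łoś's theorem for ultrapowers. -/
theorem sat_germ {I : Type} (U : Ultrafilter I) (φ : Fml) (v : ℕ → I → M) :
    Sat (Germ.LiftRel EM (l := (U : Filter I))) (fun k => (v k : Germ (U : Filter I) M)) φ ↔
      ∀ᶠ i in (U : Filter I), Sat EM (fun k => v k i) φ := by
  have key : ∀ (v : ℕ → I → M) (i : ℕ) (g : I → M),
      Function.update (fun k => (v k : Germ (U : Filter I) M)) i g =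
        fun k => (Function.update v i g k : Germ (U : Filter I) M) := by
    intro v i g
    funext k
    by_cases hk : k = i
    · subst hk; simp
    · simp [hk]
  have key' : ∀ (v : ℕ → I → M) (i : ℕ) (g : I → M) (t : I),
      (fun k => Function.update v i g k t) = Function.update (fun k => v k t) i (g t) := by
    intro v i g t
    funext k
    by_cases hk : k = i
    · subst hk; simp
    · simp [hk]
  induction φ generalizing v with
  | mem i j => exact Germ.liftRel_coe
  | eq i j => exact Germ.coe_eq
  | not φ ih => simp only [sat_not, ih, Ultrafilter.eventually_not]
  | and φ ψ ih₁ ih₂ => simp only [sat_and, ih₁, ih₂, eventually_and]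
  | or φ ψ ih₁ ih₂ => simp only [sat_or, ih₁, ih₂, Ultrafilter.eventually_or]
  | imp φ ψ ih₁ ih₂ => simp only [sat_imp, ih₁, ih₂, Ultrafilter.eventually_imp]
  | all i φ ih =>
    simp only [sat_all]
    constructor
    · intro h
      by_contra hcon
      rw [← Ultrafilter.eventually_not] at hcon
      simp only [not_forall] at hcon
      have : Nonempty M := hcon.exists.choose_spec.nonempty
      choose! g hg using fun t (ht : ∃ a, ¬ Sat EM (Function.update (fun k => v k t) i a) φ) => ht
      have h₁ := h (g : Germ (U : Filter I) M)
      rw [key] at h₁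
      replace h₁ := (ih _).1 h₁
      simp only [key'] at h₁
      obtain ⟨t, ht, ht'⟩ := (h₁.and hcon).exists
      exact hg t ht' ht
    · intro h a
      induction a using Germ.inductionOn with | _ g
      rw [key]
      refine (ih _).2 ?_
      simp only [key']
      exact h.mono fun t ht => ht _
  | ex i φ ih =>
    simp only [sat_ex]
    constructor
    · rintro ⟨a, h⟩
      induction a using Germ.inductionOn with | _ g
      rw [key] at h
      replace h := (ih _).1 h
      simp only [key'] at h
      exact h.mono fun t ht => ⟨_, ht⟩
    · intro h
      have : Nonempty M := h.exists.choose_spec.nonempty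
      choose! g hg using fun t (ht : ∃ a, Sat EM (Function.update (fun k => v k t) i a) φ) => ht
      refine ⟨g, ?_⟩
      rw [key]
      refine (ih _).2 ?_
      simp only [key']
      exact h.mono hg

theorem SatDB0.exists_union (hM : SatDB0 EM) (a b : M) :
    ∃ u, ∀ x, EM x a ∨ EM x b → EM x u := by
  obtain ⟨p, hp⟩ := hM.2.2.1 a b
  obtain ⟨u, hu⟩ := hM.2.2.2.1 p
  refine ⟨u, ?_⟩
  rintro x (hx | hx)
  · exact (hu x).2 ⟨a, (hp a).2 (Or.inl rfl), hx⟩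
  · exact (hu x).2 ⟨b, (hp b).2 (Or.inr rfl), hx⟩

/-- If no set in `M` collects the `φ`-witnesses for elements of `p`, some elementary extension
has an element of `p` with a witness, but none in the hull. -/
theorem exists_elemEmb_of_not_collSAx (hM : SatDB0 EM) {φ : Fml} {v p : M}
    (h : ¬ ∃ q, ∀ x, EM x p → ((∃ y, Sat EM (val3 x y v) φ) ↔
      ∃ y, EM y q ∧ Sat EM (val3 x y v) φ)) :
    ∃ (N : Type) (EN : N → N → Prop) (f : M → N) (c : N), ElemEmb EM EN f ∧ EN c (f p) ∧
      (∃ y, Sat EN (val3 c y (f v)) φ) ∧ ∀ y ∈ hull EN f, ¬ Sat EN (val3 c y (f v)) φ := by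
  have h' : ∀ q, ∃ x, EM x p ∧ (∃ y, Sat EM (val3 x y v) φ) ∧
      ∀ y, EM y q → ¬ Sat EM (val3 x y v) φ := by
    intro q
    by_contra hcon
    refine h ⟨q, fun x hx => ⟨fun hy => ?_, fun ⟨y, _, hy⟩ => ⟨y, hy⟩⟩⟩
    by_contra hq
    exact hcon ⟨x, hx, hy, fun y hyq hys => hq ⟨y, hyq, hys⟩⟩
  choose c hcp hcy hc using h'
  choose y hy using hcy
  have := hM.nonempty
  have : NeBot (⨅ m : M, 𝓟 {q | ∀ x, EM x m → EM x q}) := by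
    refine iInf_neBot_of_directed (fun a b => ?_) fun m => ?_
    · obtain ⟨u, hu⟩ := hM.exists_union a b
      exact ⟨u, principal_mono.2 fun q hq x hx => hq x (hu x (Or.inl hx)),
        principal_mono.2 fun q hq x hx => hq x (hu x (Or.inr hx))⟩
    · exact principal_neBot_iff.2 ⟨m, fun _ hx => hx⟩
  set U := Ultrafilter.of (⨅ m : M, 𝓟 {q | ∀ x, EM x m → EM x q})
  have hU : ∀ m, ∀ᶠ q in (U : Filter M), ∀ x, EM x m → EM x q := fun m =>
    (Ultrafilter.of_le _ : (U : Filter M) ≤ _) (mem_iInf_of_mem m (mem_principal_self _))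
  have hval : ∀ a b : M → M, val3 (a : Germ (U : Filter M) M) b ((v : M) : Germ (U : Filter M) M) =
      fun k => ((val3 a b fun _ => v) k : Germ (U : Filter M) M) := by
    intro a b
    funext k
    rcases k with _ | _ | k <;> rfl
  have hval' : ∀ (a b : M → M) t, (fun k => (val3 a b fun _ => v) k t) = val3 (a t) (b t) v := by
    intro a b t
    funext k
    rcases k with _ | _ | k <;> rfl
  refine ⟨Germ (U : Filter M) M, Germ.LiftRel EM, fun m => (m : Germ (U : Filter M) M), c,
    fun ψ w => ?_, ?_, ⟨y, ?_⟩, ?_⟩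
  · refine Iff.trans ?_ (sat_germ U ψ fun k _ => w k).symm
    simp
  · exact Germ.liftRel_coe.2 (Eventually.of_forall hcp)
  · rw [hval, sat_germ]
    simp only [hval']
    exact Eventually.of_forall hy
  · rintro b ⟨m, hb⟩ hs
    induction b using Germ.inductionOn with | _ b
    rw [hval, sat_germ] at hs
    simp only [hval'] at hs
    obtain ⟨t, ⟨ht, ht'⟩, ht''⟩ := ((hs.and (Germ.liftRel_coe.1 hb)).and (hU m)).exists
    exact hc t _ (ht'' _ ht') ht

theorem SigmaElemInTop.of_succ {n : ℕ} {S : Set N} (h : SigmaElemInTop (n + 1) EN S) :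
    SigmaElemInTop n EN S := by
  intro φ hφ v hv
  obtain ⟨ψ, hψ, hψφ⟩ := (SDef.of_sat (K := fun _ _ => True) hφ).succ
  have hS : ∀ χ, SatIn EN S v χ ↔ Sat (fun a b : S => EN a b) (fun k => ⟨v k, hv k⟩) χ :=
    fun χ => (sat_subtype EN S χ fun k => ⟨v k, hv k⟩).symm
  have hψφ' : ∀ (N : Type) (E : N → N → Prop) v, Sat E v ψ ↔ Sat E v φ :=
    fun N E v => hψφ N E trivial v
  rw [hS, ← hψφ', ← hψφ', ← hS]
  exact h ψ hψ v hv

theorem SigmaElemInTop.pi {n : ℕ} {S : Set N} (h : SigmaElemInTop (n + 1) EN S) {φ : Fml}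
    (hφ : IsPi n φ) {v : ℕ → N} (hv : ∀ k, v k ∈ S) : SatIn EN S v φ ↔ Sat EN v φ := by
  obtain ⟨m, hm⟩ := (fv_finite φ).exists_notMem
  have hu : ∀ a, ∀ k ∈ φ.fv, Function.update v m a k = v k := fun a k hk =>
    Function.update_of_ne (fun hkm => hm (by rwa [← hkm])) _ _
  have := h (.ex m φ) ⟨m, φ, hφ, rfl⟩ v hv
  rw [sat_ex] at this
  constructor
  · intro hs
    obtain ⟨a, ha⟩ := this.1 ⟨v 0, hv 0, (satIn_congr _ _ _ _ _ (hu _)).2 hs⟩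
    exact (sat_congr _ _ _ _ (hu a)).1 ha
  · intro hs
    obtain ⟨a, -, ha⟩ := this.2 ⟨v 0, (sat_congr _ _ _ _ (hu _)).2 hs⟩
    exact (satIn_congr _ _ _ _ _ (hu a)).1 ha

theorem HasEnd.of_succ {n : ℕ} (h : HasEnd (n + 1) EM) : HasEnd n EM :=
  fun N EN f hf => (h N EN f hf).of_succ

theorem HasEnd.collSScheme {n : ℕ} (hM : SatDB0 EM) (h : HasEnd (n + 1) EM) :
    CollSScheme EM (IsSigma (n + 1)) := by
  have hMn : DB0Coll n M EM := by
    refine ⟨hM, fun hn => ?_⟩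
    obtain ⟨k, rfl⟩ := Nat.exists_eq_succ_of_ne_zero hn
    exact (HasEnd.collSScheme hM h.of_succ).collScheme
  intro φ hφ _ v p
  by_contra hcon
  obtain ⟨N, EN, f, c, hf, hcp, ⟨y, hy⟩, hno⟩ := exists_elemEmb_of_not_collSAx hM hcon
  have hN := hMn.of_elemEmb hf
  have hC : SClosed (DB0Coll n) n := sClosed_of_dB0Coll fun _ _ h => h
  obtain ⟨Q, hQ, hQφ⟩ := SDef.succ_iff.1 (SDef.of_sat (K := DB0Coll n) hφ)
  have hcomp : ∀ a y z w x : N, (scons a (scons y (scons z (val3 x w (f v)))) ∘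
      fun k => if k = 0 then 0 else if k = 1 then 3 else if k = 2 then 1 else 5) =
        scons a (val3 x y (f v)) := by
    intro a y z w x
    funext k
    rcases k with _ | _ | _ | k <;> simp [scons, val3]
  obtain ⟨χ, hχ, hχQ⟩ := (hC.ball (hC.ball (hQ.rename fun k =>
    if k = 0 then 0 else if k = 1 then 3 else if k = 2 then 1 else 5) 1) 0).exists_pi
  have hupd : ∀ z, Function.update (scons c (val3 c c (f v))) 0 z = scons z (val3 c c (f v)) := by
    intro z
    funext k
    rcases k with _ | k <;> simp [scons]
  have hsat : ∀ z, Sat EN (Function.update (scons c (val3 c c (f v))) 0 z) χ ↔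
      ∃ y, EN y z ∧ ∃ a, EN a z ∧ ¬ Q N EN (scons a (val3 c y (f v))) := by
    intro z
    rw [hupd, hχQ N EN hN]
    simp only [hcomp]
    simp only [scons, not_forall, exists_prop]
  have hcS : c ∈ hull EN f := ⟨p, hcp⟩
  have hvS : ∀ k, scons c (val3 c c (f v)) k ∈ hull EN f := by
    intro k
    have hfv := mem_hull hM hf.subStr v
    rcases k with _ | _ | _ | k
    · exact hcS
    · exact hcS
    · exact hcS
    · exact hfv
  have hend := h N EN f hf
  obtain ⟨b, hb⟩ := (hQφ N EN hN _).1 hy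
  obtain ⟨z, hz⟩ := hN.1.2.2.1 y b
  obtain ⟨z', hz'S, hz'⟩ := (hend (.ex 0 χ) ⟨0, χ, hχ, rfl⟩ _ hvS).2 ((sat_ex _ _ _ _).2
    ⟨z, (hsat z).2 ⟨y, (hz y).2 (Or.inl rfl), b, (hz b).2 (Or.inr rfl), hb⟩⟩)
  obtain ⟨y', hy'z, a, -, ha⟩ :=
    (hsat z').1 ((hend.pi hχ (forall_update_mem hvS 0 hz'S)).1 hz')
  exact hno y' (mem_hull_of_mem hM (hf.sigmaElemEmb 0) hz'S hy'z) ((hQφ N EN hN _).2 ⟨a, ha⟩)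

end Transfer

/-- For M ⊨ DB₀ and n ≥ 0, TFAE:
(1) M has property end_{n+1};
(2) M ⊨ Coll_s(Σ_{n+1});
(3) if n = 0: every Σ₁-elementary extension N ⊨ DB₀ of M makes M* ≺_{Σ₁} N;
    if n ≥ 1: M ⊨ Coll(Σ_n), and every Σ_{n+1}-elementary extension
    N ⊨ DB₀ + Coll(Σ_n) of M makes M* ≺_{Σ_{n+1}} N. -/
theorem end_tfae (n : ℕ) (M : Type) (EM : M → M → Prop) (hM : SatDB0 EM) :
    [HasEnd (n + 1) EM,
     CollSScheme EM (IsSigma (n + 1)),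
     if n = 0 then
       ∀ (N : Type) (EN : N → N → Prop) (f : M → N), SatDB0 EN →
         SubStr EM EN f → SigmaElemEmb 1 EM EN f →
         SigmaElemInTop 1 EN (hull EN f)
     else
       CollScheme EM (IsSigma n) ∧
       ∀ (N : Type) (EN : N → N → Prop) (f : M → N),
         SatDB0 EN → CollScheme EN (IsSigma n) →
         SubStr EM EN f → SigmaElemEmb (n + 1) EM EN f →
         SigmaElemInTop (n + 1) EN (hull EN f)].TFAE := by
  tfae_have 1 → 2 := HasEnd.collSScheme hM
  tfae_have 2 → 3 := by
    intro h
    split_ifs with hn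
    · subst hn
      exact fun N EN f hN _ hfS => CollSScheme.sigmaElemInTop ⟨hM, fun h => absurd rfl h⟩
        ⟨hN, fun h => absurd rfl h⟩ h hfS
    · exact ⟨h.collScheme.of_succ, fun N EN f hN hNc _ hfS =>
        CollSScheme.sigmaElemInTop ⟨hM, fun _ => h.collScheme.of_succ⟩ ⟨hN, fun _ => hNc⟩ h hfS⟩
  tfae_have 3 → 1 := by
    intro h N EN f hf
    split_ifs at h with hn
    · subst hn
      exact h N EN f (hM.of_elemEmb hf) hf.subStr (hf.sigmaElemEmb 1)
    · have := hM.nonempty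
      exact h.2 N EN f (hM.of_elemEmb hf) (h.1.of_elemEmb hf) hf.subStr (hf.sigmaElemEmb _)
  tfae_finish

end FOSet
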